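/- arXiv:2008.05436 — 4 statements merged into one kernel-verified Lean document; each statement's English description precedes it below -/
import Mathlib

section
/- Let Ω ⊂ ℝ^{n-1} be a compact measurable set and I = [a,b] ⊂ ℝ. Let G : I × Ω → (0,∞) and h : I × Ω → ℝ be continuous functions having continuous partial derivatives ∂G/∂u and ∂h/∂u on I × Ω. Define σ(u) = ∫_Ω G(u,v) dv and the effective density ρ(u) = (∫_Ω h(u,v) G(u,v) dv)/σ(u). Assume ρ'(u) ≠ 0 for all u ∈ I, fix a constant 𝒥 ∈ ℝ, and define the effective diffusion coefficient D(u) = 𝒥 σ(u)/ρ'(u). Then for every u ∈ I one has ∫_Ω λ(u,v) G(u,v) dv ≠ 0 and D(u) = 𝒥 σ(u)² / (∫_Ω λ(u,v) G(u,v) dv), where λ(u,v) = ∂h/∂u(u,v) + (h(u,v) − ρ(u)) · (∂G/∂u)(u,v)/G(u,v). -/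
open Set MeasureTheory


lemma aux_slice {m : ℕ} {Ω : Set (Fin m → ℝ)} (hΩc : IsCompact Ω)
    {a b : ℝ} {F : ℝ → (Fin m → ℝ) → ℝ}
    (hF : ContinuousOn (fun q : ℝ × (Fin m → ℝ) => F q.1 q.2) (Icc a b ×ˢ Ω))
    {u : ℝ} (hu : u ∈ Icc a b) : IntegrableOn (F u) Ω := by
  have h1 : ContinuousOn (F u) Ω :=
    hF.comp (f := fun v => (u, v)) (by fun_prop) (fun v hv => ⟨hu, hv⟩)
  exact h1.integrableOn_compact hΩc

lemma aux_deriv {m : ℕ} {Ω : Set (Fin m → ℝ)} (hΩc : IsCompact Ω) (hΩm : MeasurableSet Ω)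
    {a b : ℝ} {F F' : ℝ → (Fin m → ℝ) → ℝ}
    (hF : ContinuousOn (fun q : ℝ × (Fin m → ℝ) => F q.1 q.2) (Icc a b ×ˢ Ω))
    (hF' : ContinuousOn (fun q : ℝ × (Fin m → ℝ) => F' q.1 q.2) (Icc a b ×ˢ Ω))
    (hd : ∀ v ∈ Ω, ∀ u ∈ Icc a b,
      HasDerivWithinAt (fun u' => F u' v) (F' u v) (Icc a b) u)
    {u : ℝ} (hu : u ∈ Icc a b) :
    HasDerivWithinAt (fun u' => ∫ v in Ω, F u' v) (∫ v in Ω, F' u v) (Icc a b) u := by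
  obtain ⟨C, hC⟩ := (isCompact_Icc.prod hΩc).exists_bound_of_continuousOn hF'
  rw [hasDerivWithinAt_iff_tendsto_slope]
  have key : Filter.Tendsto (fun y => ∫ v in Ω, slope (fun u' => F u' v) u y)
      (nhdsWithin u (Icc a b \ {u})) (nhds (∫ v in Ω, F' u v)) := by
    apply tendsto_integral_filter_of_dominated_convergence (fun _ => C)
    · filter_upwards [self_mem_nhdsWithin] with y hy
      have := ((aux_slice hΩc hF hy.1).sub (aux_slice hΩc hF hu)).const_mul (y - u)⁻¹
      exact this.aestronglyMeasurable
    · filter_upwards [self_mem_nhdsWithin] with y hy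
      filter_upwards [ae_restrict_mem hΩm] with v hv
      have h1 := (convex_Icc a b).norm_image_sub_le_of_norm_hasDerivWithin_le
        (fun x hx => hd v hv x hx) (fun x hx => hC (x, v) ⟨hx, hv⟩) hu hy.1
      have h2 : 0 < ‖y - u‖ := norm_pos_iff.2 (sub_ne_zero.2 hy.2)
      rw [slope_def_field, norm_div, div_le_iff₀ h2]
      exact h1
    · exact integrableOn_const hΩc.measure_lt_top.ne
    · filter_upwards [ae_restrict_mem hΩm] with v hv
      exact hasDerivWithinAt_iff_tendsto_slope.1 (hd v hv u hu)
  refine key.congr' ?_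
  filter_upwards [self_mem_nhdsWithin] with y hy
  simp only [slope_def_field]
  rw [integral_div, integral_sub (aux_slice hΩc hF hy.1) (aux_slice hΩc hF hu)]

/-- Finite transversal diffusion rate formula in coordinates: for a parametric channel
with volume density `G` on `[a,b] × Ω` and stable solution `h` with effective density `ρ`,
the effective diffusion coefficient `D = 𝒥 σ / ρ'` can be written as
`D(u) = 𝒥 σ(u)² / ∫_Ω λ(u,v) G(u,v) dv` with
`λ = ∂h/∂u + (h − ρ) (∂G/∂u)/G`. -/
theorem effective_diffusion_finite_transversal_rate
    {m : ℕ} (Ω : Set (Fin m → ℝ)) (hΩc : IsCompact Ω) (hΩm : MeasurableSet Ω)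
    (a b : ℝ) (hab : a < b)
    (G h G' h' : ℝ → (Fin m → ℝ) → ℝ)
    (hGpos : ∀ u ∈ Icc a b, ∀ v ∈ Ω, 0 < G u v)
    (hGcont : ContinuousOn (fun q : ℝ × (Fin m → ℝ) => G q.1 q.2) (Icc a b ×ˢ Ω))
    (hhcont : ContinuousOn (fun q : ℝ × (Fin m → ℝ) => h q.1 q.2) (Icc a b ×ˢ Ω))
    (hG' : ∀ v ∈ Ω, ∀ u ∈ Icc a b,
      HasDerivWithinAt (fun u' => G u' v) (G' u v) (Icc a b) u)
    (hh' : ∀ v ∈ Ω, ∀ u ∈ Icc a b,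
      HasDerivWithinAt (fun u' => h u' v) (h' u v) (Icc a b) u)
    (hG'cont : ContinuousOn (fun q : ℝ × (Fin m → ℝ) => G' q.1 q.2) (Icc a b ×ˢ Ω))
    (hh'cont : ContinuousOn (fun q : ℝ × (Fin m → ℝ) => h' q.1 q.2) (Icc a b ×ˢ Ω))
    (σ ρ D : ℝ → ℝ) (lam : ℝ → (Fin m → ℝ) → ℝ) (𝒥 : ℝ)
    (hσ : ∀ u, σ u = ∫ v in Ω, G u v)
    (hρ : ∀ u, ρ u = (∫ v in Ω, h u v * G u v) / σ u)
    (hρ' : ∀ u ∈ Icc a b, derivWithin ρ (Icc a b) u ≠ 0)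
    (hD : ∀ u, D u = 𝒥 * σ u / derivWithin ρ (Icc a b) u)
    (hlam : ∀ u v, lam u v = h' u v + (h u v - ρ u) * G' u v / G u v) :
    ∀ u ∈ Icc a b,
      (∫ v in Ω, lam u v * G u v) ≠ 0 ∧
      D u = 𝒥 * (σ u) ^ 2 / (∫ v in Ω, lam u v * G u v) := by
  intro u hu
  have hσd := aux_deriv hΩc hΩm hGcont hG'cont hG' hu
  have hPcont : ContinuousOn (fun q : ℝ × (Fin m → ℝ) => (fun u v => h u v * G u v) q.1 q.2)
      (Icc a b ×ˢ Ω) := hhcont.mul hGcont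
  have hP'cont : ContinuousOn (fun q : ℝ × (Fin m → ℝ) =>
      (fun u v => h' u v * G u v + h u v * G' u v) q.1 q.2)
      (Icc a b ×ˢ Ω) := (hh'cont.mul hGcont).add (hhcont.mul hG'cont)
  have hPd : HasDerivWithinAt (fun u' => ∫ v in Ω, h u' v * G u' v)
      (∫ v in Ω, (h' u v * G u v + h u v * G' u v)) (Icc a b) u := aux_deriv hΩc hΩm hPcont hP'cont
    (fun v hv u hu => (hh' v hv u hu).mul (hG' v hv u hu)) hu
  have hvol : volume Ω ≠ 0 := by
    intro h0
    apply hρ' u hu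
    have : ρ = fun _ => 0 := by
      funext x
      rw [hρ, hσ, Measure.restrict_eq_zero.2 h0]
      simp
    rw [this]
    simp
  have hσpos : 0 < σ u := by
    rw [hσ, setIntegral_pos_iff_support_of_nonneg_ae]
    · have : Function.support (G u) ∩ Ω = Ω :=
        inter_eq_right.2 fun v hv => (hGpos u hu v hv).ne'
      rw [this]
      exact pos_iff_ne_zero.2 hvol
    · filter_upwards [ae_restrict_mem hΩm] with v hv
      exact (hGpos u hu v hv).le
    · exact aux_slice hΩc hGcont hu
  have hσe : (fun u' => ∫ v in Ω, G u' v) = σ := by funext x; rw [hσ]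
  rw [hσe] at hσd
  have hρd := hPd.div hσd hσpos.ne'
  have hρe : ((fun u' => ∫ v in Ω, h u' v * G u' v) / σ) = ρ := by
    funext x; rw [hρ]; rfl
  rw [hρe] at hρd
  have hder := hρd.derivWithin (uniqueDiffOn_Icc hab u hu)
  have hi1 : IntegrableOn (fun v => h' u v * G u v + h u v * G' u v) Ω :=
    aux_slice (F := fun u v => h' u v * G u v + h u v * G' u v) hΩc hP'cont hu
  have hI : (∫ v in Ω, lam u v * G u v) =
      (∫ v in Ω, (h' u v * G u v + h u v * G' u v)) - ρ u * ∫ v in Ω, G' u v := by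
    rw [← integral_const_mul, ← integral_sub hi1
      ((aux_slice hΩc hG'cont hu).const_mul _)]
    apply setIntegral_congr_fun hΩm
    intro v hv
    have := (hGpos u hu v hv).ne'
    simp only [hlam]
    field_simp
    ring
  have hI2 : (∫ v in Ω, lam u v * G u v) = σ u * derivWithin ρ (Icc a b) u := by
    rw [hI, hder, hρ u]
    have := hσpos.ne'
    field_simp
  have hne := hρ' u hu
  have hs := hσpos.ne'
  rw [hI2, hD]
  refine ⟨mul_ne_zero hs hne, ?_⟩
  field_simp
end

section
/- Let a < b and y₁, y₂ : [a,b] → ℝ be C¹ functions with y₁(x) < y₂(x) for all x ∈ [a,b]; let C = {(x,y) ∈ ℝ² : a ≤ x ≤ b, y₁(x) ≤ y ≤ y₂(x)}. Let P, J₁, J₂ be real-valued C¹ functions of (x,y,t) on a neighborhood of C × ℝ satisfying the continuity equation ∂P/∂t + ∂J₁/∂x + ∂J₂/∂y = 0 on C × ℝ, together with the no-flux (reflecting) wall conditions J₂(x, yᵢ(x), t) = yᵢ'(x) · J₁(x, yᵢ(x), t) for i = 1,2 and all x ∈ [a,b], t ∈ ℝ. Define m(u,t) = ∫_{y₁(u)}^{y₂(u)}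 P(u,y,t) dy and F(u,t) = ∫_{y₁(u)}^{y₂(u)} J₁(u,y,t) dy. Then the effective continuity equation ∂m/∂t(u,t) + ∂F/∂u(u,t) = 0 holds for all u ∈ (a,b) and t ∈ ℝ. -/
open Set intervalIntegral

open Filter Topology MeasureTheory in
lemma edge_aux (G : ℝ → ℝ → ℝ) (W : Set (ℝ × ℝ)) (hW : IsOpen W)
    (hG : ContinuousOn (fun q : ℝ × ℝ => G q.1 q.2) W) (u : ℝ) (β : ℝ → ℝ) (β' : ℝ)
    (hβ : HasDerivAt β β' u) (hu : (u, β u) ∈ W) :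
    HasDerivAt (fun x => ∫ y in β u..β x, G x y) (G u (β u) * β') u := by
  have hGc : ContinuousAt (fun q : ℝ × ℝ => G q.1 q.2) (u, β u) :=
    hG.continuousAt (hW.mem_nhds hu)
  have key : ∀ ε > 0, ∀ᶠ x in 𝓝 u, ∀ y ∈ uIcc (β u) (β x),
      (x, y) ∈ W ∧ ‖G x y - G u (β u)‖ ≤ ε := by
    intro ε hε
    have h1 : ∀ᶠ q in 𝓝 (u, β u), q ∈ W ∧ ‖G q.1 q.2 - G u (β u)‖ ≤ ε := by
      refine Filter.Eventually.and (hW.mem_nhds hu) ?_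
      have := Metric.tendsto_nhds.1 hGc ε hε
      filter_upwards [this] with q hq
      rw [dist_eq_norm] at hq
      exact hq.le
    obtain ⟨r, hr, hball⟩ := Metric.eventually_nhds_iff.1 h1
    have h2 := Metric.tendsto_nhds.1 hβ.continuousAt r hr
    filter_upwards [h2, Metric.ball_mem_nhds u hr] with x hx hx' y hy
    apply hball (y := (x, y))
    rw [Prod.dist_eq]
    refine max_lt hx' ?_
    refine lt_of_le_of_lt ?_ hx
    rw [Real.dist_eq, Real.dist_eq]
    exact abs_sub_left_of_mem_uIcc hy
  have h1 : HasDerivAt (fun x => ∫ y in β u..β x, (G x y - G u (β u))) 0 u := by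
    rw [hasDerivAt_iff_isLittleO]
    simp only [intervalIntegral.integral_same, sub_zero, smul_zero]
    refine Asymptotics.IsLittleO.trans_isBigO (g := fun x => β x - β u) ?_ hβ.differentiableAt.isBigO_sub
    rw [Asymptotics.isLittleO_iff]
    intro c hc
    filter_upwards [key c hc] with x hx
    exact intervalIntegral.norm_integral_le_of_norm_le_const
      fun y hy => (hx y (uIoc_subset_uIcc hy)).2
  have h2 : HasDerivAt (fun x => (β x - β u) * G u (β u)) (β' * G u (β u)) u :=
    (hβ.sub_const _).mul_const _
  have h3 := h1.add h2
  rw [zero_add, mul_comm] at h3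
  refine h3.congr_of_eventuallyEq ?_
  filter_upwards [key 1 one_pos] with x hx
  have hi : IntervalIntegrable (fun y => G x y) volume (β u) (β x) := by
    apply ContinuousOn.intervalIntegrable
    exact hG.comp (f := fun y : ℝ => (x, y)) (by fun_prop) (fun y hy => (hx y hy).1)
  simp only [Pi.add_apply]
  rw [intervalIntegral.integral_sub hi (by simp)]
  simp

open Filter Topology MeasureTheory in
lemma leibniz_aux (G : ℝ → ℝ → ℝ) (W : Set (ℝ × ℝ)) (hW : IsOpen W)
    (hG : ContDiffOn ℝ 1 (fun q : ℝ × ℝ => G q.1 q.2) W) (u : ℝ) (α β : ℝ → ℝ) (α' β' : ℝ)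
    (hα : HasDerivAt α α' u) (hβ : HasDerivAt β β' u) (hle : α u ≤ β u)
    (hu : ∀ y ∈ Icc (α u) (β u), (u, y) ∈ W) :
    IntervalIntegrable (fun y => deriv (fun x => G x y) u) volume (α u) (β u) ∧
    HasDerivAt (fun x => ∫ y in α x..β x, G x y)
      ((∫ y in α u..β u, deriv (fun x => G x y) u)
        + G u (β u) * β' - G u (α u) * α') u := by
  have hdiff : ∀ x y, (x, y) ∈ W → HasDerivAt (fun x => G x y)
      (fderiv ℝ (fun q : ℝ × ℝ => G q.1 q.2) (x, y) (1, 0)) x := by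
    intro x y h
    have h1 : HasFDerivAt (fun q : ℝ × ℝ => G q.1 q.2) _ (x, y) :=
      ((hG.differentiableOn (by norm_num)).differentiableAt (hW.mem_nhds h)).hasFDerivAt
    exact h1.comp_hasDerivAt (f := fun x => (x, y)) x ((hasDerivAt_id x).prodMk (hasDerivAt_const x y))
  have hK : IsCompact (({u} : Set ℝ) ×ˢ Icc (α u) (β u)) := isCompact_singleton.prod isCompact_Icc
  obtain ⟨δ, hδ, hsub⟩ := hK.exists_cthickening_subset_open hW (by
    rintro ⟨x, y⟩ ⟨h1, h2⟩
    simp only [mem_singleton_iff] at h1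
    subst h1
    exact hu y h2)
  have hbox : ∀ x ∈ Metric.closedBall u δ, ∀ y ∈ Icc (α u - δ) (β u + δ), (x, y) ∈ W := by
    intro x hx y hy
    apply hsub
    refine Metric.mem_cthickening_of_dist_le _ (u, max (α u) (min y (β u))) _ _ ⟨rfl, ?_⟩ ?_
    · exact ⟨le_max_left _ _, max_le hle (min_le_right _ _)⟩
    · rw [Prod.dist_eq]
      refine max_le hx ?_
      rw [Real.dist_eq, abs_le]
      obtain ⟨h1, h2⟩ := hy
      rcases max_cases (α u) (min y (β u)) with h | h <;>
        rcases min_cases y (β u) with h' | h' <;> constructor <;> simp only [] <;> linarith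
  have hcont := hG.continuousOn
  have hD : ContinuousOn (fun q => fderiv ℝ (fun q : ℝ × ℝ => G q.1 q.2) q (1, 0)) W :=
    (hG.continuousOn_fderiv_of_isOpen hW le_rfl).clm_apply continuousOn_const
  have hint : ∀ x ∈ Metric.closedBall u δ, ∀ c ∈ Icc (α u - δ) (β u + δ),
      ∀ d ∈ Icc (α u - δ) (β u + δ), IntervalIntegrable (fun y => G x y) volume c d := by
    intro x hx c hc d hd
    apply ContinuousOn.intervalIntegrable
    exact hcont.comp (f := fun y : ℝ => (x, y)) (by fun_prop)
      (fun y hy => hbox x hx y (ordConnected_Icc.uIcc_subset hc hd hy))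
  have hαm : α u ∈ Icc (α u - δ) (β u + δ) := ⟨by linarith, by linarith⟩
  have hβm : β u ∈ Icc (α u - δ) (β u + δ) := ⟨by linarith, by linarith⟩
  have hum : u ∈ Metric.closedBall u δ := Metric.mem_closedBall_self hδ.le
  have hsubI : uIoc (α u) (β u) ⊆ Icc (α u - δ) (β u + δ) :=
    uIoc_subset_uIcc.trans (ordConnected_Icc.uIcc_subset hαm hβm)
  obtain ⟨M, hM⟩ := ((isCompact_closedBall u δ).prod
    (isCompact_Icc (a := α u - δ) (b := β u + δ))).exists_bound_of_continuousOn
      (hD.mono (fun q hq => hbox q.1 hq.1 q.2 hq.2))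
  have hmain := intervalIntegral.hasDerivAt_integral_of_dominated_loc_of_deriv_le
    (μ := volume) (a := α u) (b := β u) (F := G)
    (F' := fun x y => fderiv ℝ (fun q : ℝ × ℝ => G q.1 q.2) (x, y) (1, 0)) (x₀ := u)
    (bound := fun _ => M) (Metric.closedBall_mem_nhds u hδ)
    (by
      filter_upwards [Metric.closedBall_mem_nhds u hδ] with x hx
      exact (intervalIntegrable_iff.1 (hint x hx _ hαm _ hβm)).aestronglyMeasurable)
    (hint u hum _ hαm _ hβm)
    (by
      refine (intervalIntegrable_iff.1 ?_).aestronglyMeasurable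
      apply ContinuousOn.intervalIntegrable
      exact hD.comp (f := fun y : ℝ => (u, y)) (by fun_prop)
        (fun y hy => hbox u hum y (ordConnected_Icc.uIcc_subset hαm hβm hy)))
    (Eventually.of_forall fun y hy x hx => hM (x, y) ⟨hx, hsubI hy⟩)
    (by simp)
    (Eventually.of_forall fun y hy x hx => hdiff x y (hbox x hx y (hsubI hy)))
  have heq : ∀ y ∈ uIcc (α u) (β u), fderiv ℝ (fun q : ℝ × ℝ => G q.1 q.2) (u, y) (1, 0)
      = deriv (fun x => G x y) u := fun y hy =>
    (hdiff u y (hbox u hum y (ordConnected_Icc.uIcc_subset hαm hβm hy))).deriv.symm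
  obtain ⟨hI, hder⟩ := hmain
  refine ⟨hI.congr (fun y hy => heq y (uIoc_subset_uIcc hy)), ?_⟩
  rw [intervalIntegral.integral_congr heq] at hder
  have h1 := edge_aux G W hW hcont u β β' hβ (hu _ ⟨hle, le_rfl⟩)
  have h2 := edge_aux G W hW hcont u α α' hα (hu _ ⟨le_rfl, hle⟩)
  refine ((hder.add h1).sub h2).congr_of_eventuallyEq ?_
  have eα := hα.continuousAt.eventually (Metric.closedBall_mem_nhds _ hδ)
  have eβ := hβ.continuousAt.eventually (Metric.closedBall_mem_nhds _ hδ)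
  filter_upwards [Metric.closedBall_mem_nhds u hδ, eα, eβ] with x hx hxα hxβ
  rw [Real.dist_eq, abs_le] at hxα hxβ
  have hxα' : α x ∈ Icc (α u - δ) (β u + δ) := ⟨by linarith, by linarith⟩
  have hxβ' : β x ∈ Icc (α u - δ) (β u + δ) := ⟨by linarith, by linarith⟩
  simp only [Pi.add_apply, Pi.sub_apply]
  rw [intervalIntegral.integral_add_adjacent_intervals (hint x hx _ hαm _ hβm)
    (hint x hx _ hβm _ hxβ'), eq_sub_iff_add_eq, add_comm,
    intervalIntegral.integral_add_adjacent_intervals (hint x hx _ hαm _ hxα')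
    (hint x hx _ hxα' _ hxβ')]

/-- Effective continuity equation for a 2D graph channel: if `(P, J₁, J₂)` are C¹ on a
neighborhood of `C × ℝ`, satisfy the continuity equation `∂P/∂t + ∂J₁/∂x + ∂J₂/∂y = 0`
on `C × ℝ`, and the flux field is tangent to the walls (no-flux reflecting boundary
conditions), then `∂m/∂t + ∂F/∂u = 0` for the cross-sectional concentration `m` and
cross-sectional flux `F`. -/
theorem effective_continuity_equation
    (a b : ℝ) (hab : a < b) (y₁ y₂ : ℝ → ℝ)
    (hy₁ : ContDiffOn ℝ 1 y₁ (Icc a b)) (hy₂ : ContDiffOn ℝ 1 y₂ (Icc a b))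
    (hlt : ∀ x ∈ Icc a b, y₁ x < y₂ x)
    (C : Set (ℝ × ℝ))
    (hC : C = {q : ℝ × ℝ | q.1 ∈ Icc a b ∧ q.2 ∈ Icc (y₁ q.1) (y₂ q.1)})
    (V : Set (ℝ × ℝ × ℝ)) (hV : IsOpen V)
    (hCV : ∀ q ∈ C, ∀ t : ℝ, (q.1, q.2, t) ∈ V)
    (P J₁ J₂ : ℝ → ℝ → ℝ → ℝ)
    (hPc : ContDiffOn ℝ 1 (fun q : ℝ × ℝ × ℝ => P q.1 q.2.1 q.2.2) V)
    (hJ₁c : ContDiffOn ℝ 1 (fun q : ℝ × ℝ × ℝ => J₁ q.1 q.2.1 q.2.2) V)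
    (hJ₂c : ContDiffOn ℝ 1 (fun q : ℝ × ℝ × ℝ => J₂ q.1 q.2.1 q.2.2) V)
    (hcont : ∀ q ∈ C, ∀ t : ℝ,
      deriv (fun s => P q.1 q.2 s) t
        + deriv (fun x => J₁ x q.2 t) q.1
        + deriv (fun y => J₂ q.1 y t) q.2 = 0)
    (hwall₁ : ∀ x ∈ Icc a b, ∀ t : ℝ,
      J₂ x (y₁ x) t = derivWithin y₁ (Icc a b) x * J₁ x (y₁ x) t)
    (hwall₂ : ∀ x ∈ Icc a b, ∀ t : ℝ,
      J₂ x (y₂ x) t = derivWithin y₂ (Icc a b) x * J₁ x (y₂ x) t)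
    (m F : ℝ → ℝ → ℝ)
    (hm : ∀ u t, m u t = ∫ y in y₁ u..y₂ u, P u y t)
    (hF : ∀ u t, F u t = ∫ y in y₁ u..y₂ u, J₁ u y t) :
    ∀ u ∈ Ioo a b, ∀ t : ℝ,
      deriv (fun s => m u s) t + deriv (fun x => F x t) u = 0 := by
  intro u hu t
  have huI : u ∈ Icc a b := Ioo_subset_Icc_self hu
  have hn : Icc a b ∈ nhds u := Icc_mem_nhds hu.1 hu.2
  have hd₁ : HasDerivAt y₁ (derivWithin y₁ (Icc a b) u) u :=
    ((hy₁.differentiableOn (by norm_num)) u huI).hasDerivWithinAt.hasDerivAt hn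
  have hd₂ : HasDerivAt y₂ (derivWithin y₂ (Icc a b) u) u :=
    ((hy₂.differentiableOn (by norm_num)) u huI).hasDerivWithinAt.hasDerivAt hn
  have hle := (hlt u huI).le
  have hmemC : ∀ y ∈ Icc (y₁ u) (y₂ u), (u, y) ∈ C := fun y hy => by
    rw [hC]; exact ⟨huI, hy⟩
  have hmemV : ∀ y ∈ Icc (y₁ u) (y₂ u), ∀ s, (u, y, s) ∈ V := fun y hy s =>
    hCV _ (hmemC y hy) s
  -- time derivative
  obtain ⟨iP, dP⟩ := leibniz_aux (fun s y => P u y s) ((fun q : ℝ × ℝ => (u, q.2, q.1)) ⁻¹' V)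
    (hV.preimage (by fun_prop))
    (hPc.comp (f := fun q : ℝ × ℝ => (u, q.2, q.1)) (by fun_prop) (fun q hq => hq)) t
    (fun _ => y₁ u) (fun _ => y₂ u) 0 0 (hasDerivAt_const _ _) (hasDerivAt_const _ _) hle
    (fun y hy => hmemV y hy t)
  obtain ⟨iJ, dJ⟩ := leibniz_aux (fun x y => J₁ x y t) ((fun q : ℝ × ℝ => (q.1, q.2, t)) ⁻¹' V)
    (hV.preimage (by fun_prop))
    (hJ₁c.comp (f := fun q : ℝ × ℝ => (q.1, q.2, t)) (by fun_prop) (fun q hq => hq)) u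
    y₁ y₂ _ _ hd₁ hd₂ hle (fun y hy => hmemV y hy t)
  have em : (fun s => m u s) = fun s => ∫ y in y₁ u..y₂ u, P u y s := funext fun s => hm u s
  have eF : (fun x => F x t) = fun x => ∫ y in y₁ x..y₂ x, J₁ x y t := funext fun x => hF x t
  rw [em, eF, dP.deriv, dJ.deriv]
  have hsum : ∀ y ∈ uIcc (y₁ u) (y₂ u), HasDerivAt (fun y => J₂ u y t)
      (-(deriv (fun s => P u y s) t + deriv (fun x => J₁ x y t) u)) y := by
    intro y hy
    rw [uIcc_of_le hle] at hy
    have h1 : DifferentiableAt ℝ (fun y => J₂ u y t) y := by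
      have := (hJ₂c.differentiableOn (by norm_num)).differentiableAt (hV.mem_nhds (hmemV y hy t))
      exact this.comp (f := fun y : ℝ => (u, y, t)) y (by fun_prop)
    have h2 := hcont _ (hmemC y hy) t
    simp only at h2
    have h3 := h1.hasDerivAt
    rwa [show deriv (fun y => J₂ u y t) y
      = -(deriv (fun s => P u y s) t + deriv (fun x => J₁ x y t) u) by linarith] at h3
  have hftc := intervalIntegral.integral_eq_sub_of_hasDerivAt hsum (iP.add iJ).neg
  rw [intervalIntegral.integral_neg, intervalIntegral.integral_add iP iJ,
    hwall₁ u huI t, hwall₂ u huI t] at hftc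
  linarith
end

section
/- Let a < b and y₁, y₂ : [a,b] → ℝ be C¹ functions with y₁(x) < y₂(x) for all x ∈ [a,b]; let C = {(x,y) ∈ ℝ² : a ≤ x ≤ b, y₁(x) ≤ y ≤ y₂(x)}. Let h be a real-valued C² function on a neighborhood of C which is harmonic on C, i.e. ∂²h/∂x² + ∂²h/∂y² = 0, and whose gradient has no flux across the walls: ∂h/∂y(x, yᵢ(x)) = yᵢ'(x) · ∂h/∂x(x, yᵢ(x)) for i = 1,2 and all x ∈ [a,b]. Then the flux function 𝒥(u) = ∫_{y₁(u)}^{y₂(u)} ∂h/∂x(u,y) dy is constant on [a,b]. -/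
open Set intervalIntegral

theorem flux_aux (a b : ℝ) (G G' : ℝ → ℝ → ℝ)
    (hG : ContinuousOn (fun q : ℝ × ℝ => G q.1 q.2) (Icc a b ×ˢ Icc (0:ℝ) 1))
    (hG' : ContinuousOn (fun q : ℝ × ℝ => G' q.1 q.2) (Icc a b ×ˢ Icc (0:ℝ) 1))
    (hd : ∀ u ∈ Ioo a b, ∀ t ∈ Icc (0:ℝ) 1, HasDerivAt (fun x => G x t) (G' u t) u)
    (h0 : ∀ u ∈ Ioo a b, ∫ t in (0:ℝ)..1, G' u t = 0) :
    ∀ u₁ ∈ Icc a b, ∀ u₂ ∈ Icc a b,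
      ∫ t in (0:ℝ)..1, G u₁ t = ∫ t in (0:ℝ)..1, G u₂ t := by
  have hcomp : IsCompact (Icc a b ×ˢ Icc (0:ℝ) 1) := isCompact_Icc.prod isCompact_Icc
  obtain ⟨M, hM⟩ := hcomp.exists_bound_of_continuousOn hG
  obtain ⟨M', hM'⟩ := hcomp.exists_bound_of_continuousOn hG'
  have hsub : uIoc (0:ℝ) 1 ⊆ Icc 0 1 := by
    rw [uIoc_of_le zero_le_one]; exact Ioc_subset_Icc_self
  have sec : ∀ (H : ℝ → ℝ → ℝ),
      ContinuousOn (fun q : ℝ × ℝ => H q.1 q.2) (Icc a b ×ˢ Icc (0:ℝ) 1) →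
      ∀ u ∈ Icc a b, ContinuousOn (fun t => H u t) (Icc 0 1) := by
    intro H hH u hu
    exact hH.comp (f := fun t : ℝ => (u, t)) (by fun_prop) (fun t ht => ⟨hu, ht⟩)
  have meas : ∀ (H : ℝ → ℝ → ℝ),
      ContinuousOn (fun q : ℝ × ℝ => H q.1 q.2) (Icc a b ×ˢ Icc (0:ℝ) 1) →
      ∀ u ∈ Icc a b, MeasureTheory.AEStronglyMeasurable (fun t => H u t)
        (MeasureTheory.volume.restrict (uIoc (0:ℝ) 1)) := by
    intro H hH u hu
    exact ((sec H hH u hu).mono hsub).aestronglyMeasurable measurableSet_uIoc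
  have hcont : ContinuousOn (fun u => ∫ t in (0:ℝ)..1, G u t) (Icc a b) := by
    intro u hu
    apply intervalIntegral.continuousWithinAt_of_dominated_interval (bound := fun _ => M)
    · filter_upwards [self_mem_nhdsWithin] with x hx using meas G hG x hx
    · filter_upwards [self_mem_nhdsWithin] with x hx
      exact Filter.Eventually.of_forall fun t ht => hM (x, t) ⟨hx, hsub ht⟩
    · simp
    · refine Filter.Eventually.of_forall fun t ht => ?_
      exact (hG.comp (f := fun x : ℝ => (x, t)) (by fun_prop)
        (fun x hx => ⟨hx, hsub ht⟩)) u hu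
  have hder : ∀ u ∈ Ioo a b, HasDerivAt (fun u => ∫ t in (0:ℝ)..1, G u t) 0 u := by
    intro u hu
    have hu' := Ioo_subset_Icc_self hu
    have hn : Ioo a b ∈ nhds u := isOpen_Ioo.mem_nhds hu
    have := (intervalIntegral.hasDerivAt_integral_of_dominated_loc_of_deriv_le
      (F := G) (F' := G') (a := 0) (b := 1) (μ := MeasureTheory.volume)
      (bound := fun _ => M') hn
      (by filter_upwards [hn] with x hx using meas G hG x (Ioo_subset_Icc_self hx))
      (by
        apply ContinuousOn.intervalIntegrable
        rw [uIcc_of_le zero_le_one]; exact sec G hG u hu')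
      (meas G' hG' u hu')
      (Filter.Eventually.of_forall fun t ht x hx =>
        hM' (x, t) ⟨Ioo_subset_Icc_self hx, hsub ht⟩)
      (by simp)
      (Filter.Eventually.of_forall fun t ht x hx => hd x hx t (hsub ht))).2
    rwa [h0 u hu] at this
  have key : ∀ u ∈ Icc a b, (∫ t in (0:ℝ)..1, G u t) = ∫ t in (0:ℝ)..1, G a t := by
    intro u hu
    rcases hu.1.eq_or_lt with rfl | hau
    · rfl
    obtain ⟨c, hc, hceq⟩ := exists_hasDerivAt_eq_slope (fun u => ∫ t in (0:ℝ)..1, G u t)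
      (fun _ => 0) hau (hcont.mono (Icc_subset_Icc_right hu.2))
      (fun x hx => hder x ⟨hx.1, hx.2.trans_le hu.2⟩)
    have hne : u - a ≠ 0 := (sub_pos.2 hau).ne'
    rw [eq_div_iff hne] at hceq
    linarith
  intro u₁ h1 u₂ h2
  rw [key u₁ h1, key u₂ h2]

theorem flux_of_harmonic_is_constant
    (a b : ℝ) (hab : a < b) (y₁ y₂ : ℝ → ℝ)
    (hy₁ : ContDiffOn ℝ 1 y₁ (Icc a b)) (hy₂ : ContDiffOn ℝ 1 y₂ (Icc a b))
    (hlt : ∀ x ∈ Icc a b, y₁ x < y₂ x)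
    (C : Set (ℝ × ℝ))
    (hC : C = {q : ℝ × ℝ | q.1 ∈ Icc a b ∧ q.2 ∈ Icc (y₁ q.1) (y₂ q.1)})
    (V : Set (ℝ × ℝ)) (hV : IsOpen V) (hCV : C ⊆ V)
    (h : ℝ → ℝ → ℝ)
    (hh : ContDiffOn ℝ 2 (fun q : ℝ × ℝ => h q.1 q.2) V)
    (hharm : ∀ q ∈ C,
      deriv (fun x => deriv (fun x' => h x' q.2) x) q.1
        + deriv (fun y => deriv (fun y' => h q.1 y') y) q.2 = 0)
    (hwall₁ : ∀ x ∈ Icc a b,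
      deriv (fun y => h x y) (y₁ x)
        = derivWithin y₁ (Icc a b) x * deriv (fun x' => h x' (y₁ x)) x)
    (hwall₂ : ∀ x ∈ Icc a b,
      deriv (fun y => h x y) (y₂ x)
        = derivWithin y₂ (Icc a b) x * deriv (fun x' => h x' (y₂ x)) x)
    (𝒥 : ℝ → ℝ)
    (h𝒥 : ∀ u, 𝒥 u = ∫ y in y₁ u..y₂ u, deriv (fun x => h x y) u) :
    ∀ u₁ ∈ Icc a b, ∀ u₂ ∈ Icc a b, 𝒥 u₁ = 𝒥 u₂ := by
  -- partial derivatives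
  have line1 : ∀ x y : ℝ, HasDerivAt (fun s : ℝ => (s, y)) ((1:ℝ), (0:ℝ)) x := fun x y =>
    (hasDerivAt_id x).prodMk (hasDerivAt_const x y)
  have line2 : ∀ x y : ℝ, HasDerivAt (fun s : ℝ => (x, s)) ((0:ℝ), (1:ℝ)) y := fun x y =>
    (hasDerivAt_const y x).prodMk (hasDerivAt_id y)
  obtain ⟨p, hp⟩ : ∃ p : ℝ × ℝ → ℝ, p = fun q =>
    fderiv ℝ (fun q : ℝ × ℝ => h q.1 q.2) q ((1:ℝ), (0:ℝ)) := ⟨_, rfl⟩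
  obtain ⟨r, hr⟩ : ∃ r : ℝ × ℝ → ℝ, r = fun q =>
    fderiv ℝ (fun q : ℝ × ℝ => h q.1 q.2) q ((0:ℝ), (1:ℝ)) := ⟨_, rfl⟩
  have hF : ContDiffOn ℝ 1 (fderiv ℝ (fun q : ℝ × ℝ => h q.1 q.2)) V :=
    hh.fderiv_of_isOpen hV (by norm_num)
  have hpC : ContDiffOn ℝ 1 p V := by rw [hp]; exact hF.clm_apply contDiffOn_const
  have hrC : ContDiffOn ℝ 1 r V := by rw [hr]; exact hF.clm_apply contDiffOn_const
  have hfd : ∀ q ∈ V, HasFDerivAt (fun q : ℝ × ℝ => h q.1 q.2)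
      (fderiv ℝ (fun q : ℝ × ℝ => h q.1 q.2) q) q := fun q hq =>
    ((hh.differentiableOn (by norm_num)).differentiableAt (hV.mem_nhds hq)).hasFDerivAt
  have hpd : ∀ q ∈ V, HasFDerivAt p (fderiv ℝ p q) q := fun q hq =>
    ((hpC.differentiableOn (by norm_num)).differentiableAt (hV.mem_nhds hq)).hasFDerivAt
  have hrd : ∀ q ∈ V, HasFDerivAt r (fderiv ℝ r q) q := fun q hq =>
    ((hrC.differentiableOn (by norm_num)).differentiableAt (hV.mem_nhds hq)).hasFDerivAt
  have hdx : ∀ x y, (x, y) ∈ V → deriv (fun s => h s y) x = p (x, y) := by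
    intro x y hq
    rw [hp]
    exact ((hfd (x, y) hq).comp_hasDerivAt x (line1 x y)).deriv
  have hdy : ∀ x y, (x, y) ∈ V → deriv (fun s => h x s) y = r (x, y) := by
    intro x y hq
    rw [hr]
    exact ((hfd (x, y) hq).comp_hasDerivAt y (line2 x y)).deriv
  have hdxx : ∀ x y, (x, y) ∈ V →
      deriv (fun s => deriv (fun s' => h s' y) s) x = fderiv ℝ p (x, y) (1, 0) := by
    intro x y hq
    have e : (fun s => deriv (fun s' => h s' y) s) =ᶠ[nhds x] fun s => p (s, y) := by
      filter_upwards [(line1 x y).continuousAt.preimage_mem_nhds (hV.mem_nhds hq)] with s hs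
      exact hdx s y hs
    rw [e.deriv_eq]
    exact ((hpd (x, y) hq).comp_hasDerivAt x (line1 x y)).deriv
  have hdyy : ∀ x y, (x, y) ∈ V →
      deriv (fun s => deriv (fun s' => h x s') s) y = fderiv ℝ r (x, y) (0, 1) := by
    intro x y hq
    have e : (fun s => deriv (fun s' => h x s') s) =ᶠ[nhds y] fun s => r (x, s) := by
      filter_upwards [(line2 x y).continuousAt.preimage_mem_nhds (hV.mem_nhds hq)] with s hs
      exact hdy x s hs
    rw [e.deriv_eq]
    exact ((hrd (x, y) hq).comp_hasDerivAt y (line2 x y)).deriv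
  have split : ∀ (L : ℝ × ℝ →L[ℝ] ℝ) (c d : ℝ), L (c, d) = c * L (1, 0) + d * L (0, 1) := by
    intro L c d
    have : ((c, d) : ℝ × ℝ) = c • ((1:ℝ), (0:ℝ)) + d • ((0:ℝ), (1:ℝ)) := by simp
    rw [this, map_add, map_smul, map_smul]; simp
  obtain ⟨d₁, hd₁⟩ : ∃ d, d = derivWithin y₁ (Icc a b) := ⟨_, rfl⟩
  obtain ⟨d₂, hd₂⟩ : ∃ d, d = derivWithin y₂ (Icc a b) := ⟨_, rfl⟩
  have cd₁ : ContinuousOn d₁ (Icc a b) := by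
    rw [hd₁]; exact hy₁.continuousOn_derivWithin (uniqueDiffOn_Icc hab) le_rfl
  have cd₂ : ContinuousOn d₂ (Icc a b) := by
    rw [hd₂]; exact hy₂.continuousOn_derivWithin (uniqueDiffOn_Icc hab) le_rfl
  have hD₁ : ∀ x ∈ Ioo a b, HasDerivAt y₁ (d₁ x) x := fun x hx => by
    rw [hd₁]
    exact ((hy₁.differentiableOn (by norm_num)) x
      (Ioo_subset_Icc_self hx)).hasDerivWithinAt.hasDerivAt (Icc_mem_nhds hx.1 hx.2)
  have hD₂ : ∀ x ∈ Ioo a b, HasDerivAt y₂ (d₂ x) x := fun x hx => by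
    rw [hd₂]
    exact ((hy₂.differentiableOn (by norm_num)) x
      (Ioo_subset_Icc_self hx)).hasDerivWithinAt.hasDerivAt (Icc_mem_nhds hx.1 hx.2)
  have hYC : ∀ u ∈ Icc a b, ∀ t ∈ Icc (0:ℝ) 1, (u, y₁ u + t * (y₂ u - y₁ u)) ∈ C := by
    intro u hu t ht
    rw [hC]
    have := hlt u hu
    refine ⟨hu, ?_, ?_⟩
    · have := mul_nonneg ht.1 (sub_pos.2 this).le
      simp only; linarith
    · have := mul_nonneg (sub_nonneg.2 ht.2) (sub_pos.2 this).le
      simp only; linarith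
  have hYV : ∀ u ∈ Icc a b, ∀ t ∈ Icc (0:ℝ) 1, (u, y₁ u + t * (y₂ u - y₁ u)) ∈ V :=
    fun u hu t ht => hCV (hYC u hu t ht)
  have hlap : ∀ q ∈ C, fderiv ℝ p q (1, 0) + fderiv ℝ r q (0, 1) = 0 := by
    rintro ⟨x, y⟩ hq
    rw [← hdxx x y (hCV hq), ← hdyy x y (hCV hq)]
    exact hharm (x, y) hq
  -- the rescaled integrand
  obtain ⟨G, hGdef⟩ : ∃ G : ℝ → ℝ → ℝ, G = fun u t =>
    p (u, y₁ u + t * (y₂ u - y₁ u)) * (y₂ u - y₁ u) := ⟨_, rfl⟩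
  obtain ⟨G', hG'def⟩ : ∃ G' : ℝ → ℝ → ℝ, G' = fun u t =>
    fderiv ℝ p (u, y₁ u + t * (y₂ u - y₁ u)) (1, d₁ u + t * (d₂ u - d₁ u)) * (y₂ u - y₁ u)
      + p (u, y₁ u + t * (y₂ u - y₁ u)) * (d₂ u - d₁ u) := ⟨_, rfl⟩
  have hJG : ∀ u ∈ Icc a b, 𝒥 u = ∫ t in (0:ℝ)..1, G u t := by
    intro u hu
    have e : ∫ y in y₁ u..y₂ u, deriv (fun x => h x y) u = ∫ y in y₁ u..y₂ u, p (u, y) := by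
      apply integral_congr
      intro y hy
      rw [uIcc_of_le (hlt u hu).le] at hy
      exact hdx u y (hCV (by rw [hC]; exact ⟨hu, hy⟩))
    rw [h𝒥, e, hGdef]
    simp only
    rw [intervalIntegral.integral_mul_const]
    have := intervalIntegral.mul_integral_comp_add_mul (a := 0) (b := 1)
      (f := fun y => p (u, y)) (c := y₂ u - y₁ u) (d := y₁ u)
    simp only [mul_zero, add_zero, mul_one, add_sub_cancel] at this
    rw [← this, mul_comm]
    congr 1
    apply integral_congr
    intro t _
    simp only [mul_comm]
  set S := Icc a b ×ˢ Icc (0:ℝ) 1 with hS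
  have m1 : MapsTo (Prod.fst : ℝ × ℝ → ℝ) S (Icc a b) := fun q hq => hq.1
  have c1 : ContinuousOn (fun q : ℝ × ℝ => y₁ q.1) S :=
    hy₁.continuousOn.comp continuousOn_fst m1
  have c2 : ContinuousOn (fun q : ℝ × ℝ => y₂ q.1) S :=
    hy₂.continuousOn.comp continuousOn_fst m1
  have c3 : ContinuousOn (fun q : ℝ × ℝ => d₁ q.1) S := cd₁.comp continuousOn_fst m1
  have c4 : ContinuousOn (fun q : ℝ × ℝ => d₂ q.1) S := cd₂.comp continuousOn_fst m1
  have cY : ContinuousOn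
      (fun q : ℝ × ℝ => (q.1, y₁ q.1 + q.2 * (y₂ q.1 - y₁ q.1))) S :=
    continuousOn_fst.prodMk (c1.add (continuousOn_snd.mul (c2.sub c1)))
  have mY : MapsTo (fun q : ℝ × ℝ => (q.1, y₁ q.1 + q.2 * (y₂ q.1 - y₁ q.1))) S V :=
    fun q hq => hYV q.1 hq.1 q.2 hq.2
  have cp := hpC.continuousOn.comp cY mY
  have cfp := (hpC.continuousOn_fderiv_of_isOpen hV le_rfl).comp cY mY
  have hGc : ContinuousOn (fun q : ℝ × ℝ => G q.1 q.2) S := by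
    rw [hGdef]
    exact cp.mul (c2.sub c1)
  have hG'c : ContinuousOn (fun q : ℝ × ℝ => G' q.1 q.2) S := by
    rw [hG'def]
    refine ((cfp.clm_apply ?_).mul (c2.sub c1)).add (cp.mul (c4.sub c3))
    exact continuousOn_const.prodMk (c3.add (continuousOn_snd.mul (c4.sub c3)))
  have hGd : ∀ u ∈ Ioo a b, ∀ t ∈ Icc (0:ℝ) 1, HasDerivAt (fun x => G x t) (G' u t) u := by
    intro u hu t ht
    rw [hGdef, hG'def]
    have hw := (hD₂ u hu).sub (hD₁ u hu)
    have hY := (hasDerivAt_id u).prodMk ((hD₁ u hu).add (hw.const_mul t))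
    exact ((hpd _ (hYV u (Ioo_subset_Icc_self hu) t ht)).comp_hasDerivAt u hY).mul hw
  have hzero : ∀ u ∈ Ioo a b, ∫ t in (0:ℝ)..1, G' u t = 0 := by
    intro u hu
    have hu' := Ioo_subset_Icc_self hu
    have hK : ∀ t ∈ uIcc (0:ℝ) 1, HasDerivAt (fun t =>
        p (u, y₁ u + t * (y₂ u - y₁ u)) * (d₁ u + t * (d₂ u - d₁ u))
          - r (u, y₁ u + t * (y₂ u - y₁ u))) (G' u t) t := by
      intro t ht
      rw [uIcc_of_le zero_le_one] at ht
      have hl : ∀ c d : ℝ, HasDerivAt (fun t : ℝ => c + t * d) d t := fun c d => by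
        simpa using ((hasDerivAt_id t).mul_const d).const_add c
      have hY := (hasDerivAt_const t u).prodMk (hl (y₁ u) (y₂ u - y₁ u))
      have h1 := (hpd _ (hYV u hu' t ht)).comp_hasDerivAt t hY
      have h2 := (hrd _ (hYV u hu' t ht)).comp_hasDerivAt t hY
      have h3 := (h1.mul (hl (d₁ u) (d₂ u - d₁ u))).sub h2
      refine h3.congr_deriv ?_
      have hL := hlap _ (hYC u hu' t ht)
      rw [hG'def]
      simp only [Function.comp]
      rw [split _ 0 (y₂ u - y₁ u), split (fderiv ℝ r _) 0 (y₂ u - y₁ u),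
        split _ 1 (d₁ u + t * (d₂ u - d₁ u))]
      linear_combination (-(y₂ u - y₁ u)) * hL
    rw [integral_eq_sub_of_hasDerivAt hK]
    · have hv1 := hYV u hu' 0 (by simp)
      have hv2 := hYV u hu' 1 (by simp)
      simp only [zero_mul, add_zero, one_mul, add_sub_cancel] at hv1 hv2 ⊢
      have w1 := hwall₁ u hu'
      have w2 := hwall₂ u hu'
      rw [hdy _ _ hv1, hdx _ _ hv1, ← hd₁] at w1
      rw [hdy _ _ hv2, hdx _ _ hv2, ← hd₂] at w2
      rw [w1, w2]; ring
    · apply ContinuousOn.intervalIntegrable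
      rw [uIcc_of_le zero_le_one]
      exact hG'c.comp (f := fun t : ℝ => (u, t)) (by fun_prop) (fun t ht => ⟨hu', ht⟩)
  intro u₁ h1 u₂ h2
  rw [hJG u₁ h1, hJG u₂ h2]
  exact flux_aux a b G G' hGc hG'c hGd hzero u₁ h1 u₂ h2
end

section
/- Let W ⊂ ℝ × ℝ^{n-1} be open and φ : W → ℝⁿ a C¹ diffeomorphism onto an open subset of ℝⁿ, and let u : φ(W) → ℝ be the first component of φ⁻¹. Write g(u,v) for the n×n matrix Dφ(u,v)ᵀ Dφ(u,v) and e₁ for the first standard basis vector of ℝⁿ. Then for every (u,v) ∈ W: (i) the gradient of the function u at the point x = φ(u,v) (the vector representing the derivative of u via the Euclidean inner product) equals Dφ(u,v) applied to the vector g(u,v)⁻¹ e₁; and (ii) the first entry of g(u,v)⁻¹ e₁ equals det g_v(u,v) / det g(u,v), where g_v is the (n−1)×(n−1) submatrix of g obtained by deleting the first row and first column. -/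
open Matrix

/-- For a parametric channel `x = φ(u,v)` with pullback metric `g = Dφᵀ Dφ`, the
gradient of the projection function `u` (the first component of `φ⁻¹`) at `φ(u,v)` is
`Dφ (g⁻¹ e₁)`, and the first entry of `g⁻¹ e₁` equals `det g_v / det g`, where `g_v` is
the submatrix of `g` obtained by deleting the first row and column. -/
theorem gradient_of_projection_function
    {m : ℕ} (W : Set (Fin (m + 1) → ℝ)) (hW : IsOpen W)
    (φ : (Fin (m + 1) → ℝ) → EuclideanSpace ℝ (Fin (m + 1)))
    (hφ : ContDiffOn ℝ 1 φ W) (hinj : Set.InjOn φ W)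
    (himg : IsOpen (φ '' W))
    (ψ : EuclideanSpace ℝ (Fin (m + 1)) → (Fin (m + 1) → ℝ))
    (hψ : ∀ p ∈ W, ψ (φ p) = p)
    (hψc : ContDiffOn ℝ 1 ψ (φ '' W))
    (u : EuclideanSpace ℝ (Fin (m + 1)) → ℝ) (hu : ∀ x, u x = ψ x 0)
    (J : (Fin (m + 1) → ℝ) → Matrix (Fin (m + 1)) (Fin (m + 1)) ℝ)
    (hJ : ∀ p i j, J p i j = fderiv ℝ φ p (Pi.single j 1) i)
    (g : (Fin (m + 1) → ℝ) → Matrix (Fin (m + 1)) (Fin (m + 1)) ℝ)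
    (hg : ∀ p, g p = (J p)ᵀ * J p) :
    ∀ p ∈ W,
      (∀ i, gradient u (φ p) i = ((J p).mulVec ((g p)⁻¹.mulVec (Pi.single 0 1))) i)
      ∧ ((g p)⁻¹.mulVec (Pi.single 0 1)) 0
          = ((g p).submatrix Fin.succ Fin.succ).det / (g p).det := by
  intro p hp
  have hA : HasFDerivAt φ (fderiv ℝ φ p) p :=
    ((hφ.differentiableOn (by norm_num)).differentiableAt (hW.mem_nhds hp)).hasFDerivAt
  have hB : HasFDerivAt ψ (fderiv ℝ ψ (φ p)) (φ p) :=
    ((hψc.differentiableOn (by norm_num)).differentiableAt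
      (himg.mem_nhds ⟨p, hp, rfl⟩)).hasFDerivAt
  set A := fderiv ℝ φ p with hAdef
  set B := fderiv ℝ ψ (φ p) with hBdef
  have hBA : B.comp A = ContinuousLinearMap.id ℝ _ := by
    have h1 := hB.comp p hA
    have h2 : HasFDerivAt (ψ ∘ φ) (ContinuousLinearMap.id ℝ _) p := by
      refine (hasFDerivAt_id p).congr_of_eventuallyEq ?_
      filter_upwards [hW.mem_nhds hp] with q hq
      exact hψ q hq
    exact h1.unique h2
  let K : Matrix (Fin (m + 1)) (Fin (m + 1)) ℝ :=
    fun i j => B (EuclideanSpace.single j 1) i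
  have hsum : ∀ x : EuclideanSpace ℝ (Fin (m + 1)),
      x = ∑ k, x k • EuclideanSpace.single k (1 : ℝ) := by
    intro x
    have h := (EuclideanSpace.basisFun (Fin (m + 1)) ℝ).sum_repr x
    simpa using h.symm
  have hKJ : K * J p = 1 := by
    ext i j
    have h1 : B (A (Pi.single j 1)) = Pi.single j 1 := by
      have := congrArg (fun T => T (Pi.single j 1)) hBA
      simpa using this
    rw [hsum (A (Pi.single j 1)), map_sum] at h1
    have h2 := congrFun h1 i
    rw [Finset.sum_apply] at h2
    simp only [map_smul, Pi.smul_apply, smul_eq_mul] at h2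
    rw [Matrix.mul_apply, Matrix.one_apply, ← Pi.single_apply j (1 : ℝ) i, ← h2]
    refine Finset.sum_congr rfl fun k _ => ?_
    rw [hJ]
    exact mul_comm _ _
  have hJK : J p * K = 1 := mul_eq_one_comm.mp hKJ
  have hginv : (g p)⁻¹ = K * Kᵀ := by
    apply Matrix.inv_eq_right_inv
    rw [hg, Matrix.mul_assoc, ← Matrix.mul_assoc (J p), hJK, Matrix.one_mul,
      ← Matrix.transpose_mul, hKJ, Matrix.transpose_one]
  have hud : HasFDerivAt u ((ContinuousLinearMap.proj 0).comp B) (φ p) := by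
    have : u = fun x => ψ x 0 := funext hu
    rw [this]
    exact (hasFDerivAt_pi'.mp hB) 0
  refine ⟨fun i => ?_, ?_⟩
  · rw [hginv, Matrix.mulVec_mulVec, ← Matrix.mul_assoc, hJK, Matrix.one_mul]
    have h1 : gradient u (φ p) i
        = inner ℝ (gradient u (φ p)) (EuclideanSpace.single i (1 : ℝ)) := by
      rw [EuclideanSpace.inner_single_right]
      simp only [one_mul, conj_trivial]
    rw [h1, gradient, InnerProductSpace.toDual_symm_apply, hud.fderiv]
    simp [K]
    rfl
  · rw [Matrix.inv_def, Matrix.smul_mulVec, Matrix.mulVec_single_one]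
    simp [Matrix.adjugate_fin_succ_eq_det_submatrix, div_eq_inv_mul]
end
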